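/- Every bounded solution of the linearized Liouville equation is a linear combination of the three explicit kernel elements: if φ : ℝ² → ℝ is a twice continuously differentiable function satisfying Δφ + 8/(1+|z|²)² φ = 0 on ℝ² and ‖φ‖_{L^∞(ℝ²)} ≤ c for some constant c > 0, then there exist constants b₀, b₁, b₂ ∈ ℝ such that φ(z) = b₀ Y₀(z) + b₁ Y₁(z) + b₂ Y₂(z) for all z ∈ ℝ², where Y₀(z) = (1 − |z|²)/(1 + |z|²), Y₁(z) = z₁/(1 + |z|²), Y₂(z) = z₂/(1 + |z|²). -/

import Mathlib

/-- The standard Laplacian on `ℝ²`. -/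
noncomputable def lap (f : ℝ × ℝ → ℝ) (z : ℝ × ℝ) : ℝ :=
  deriv (deriv (fun x => f (x, z.2))) z.1 + deriv (deriv (fun y => f (z.1, y))) z.2

/-- `Y₀(z) = (1 − |z|²)/(1 + |z|²)`. -/
noncomputable def Y0 (z : ℝ × ℝ) : ℝ :=
  (1 - (z.1 ^ 2 + z.2 ^ 2)) / (1 + (z.1 ^ 2 + z.2 ^ 2))

/-- `Y₁(z) = z₁/(1 + |z|²)`. -/
noncomputable def Y1 (z : ℝ × ℝ) : ℝ := z.1 / (1 + (z.1 ^ 2 + z.2 ^ 2))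

/-- `Y₂(z) = z₂/(1 + |z|²)`. -/
noncomputable def Y2 (z : ℝ × ℝ) : ℝ := z.2 / (1 + (z.1 ^ 2 + z.2 ^ 2))

open Real Set Filter Topology

lemma const_of_deriv_zero_aux (u : ℝ → ℝ) (s : Set ℝ) (hs : Convex ℝ s)
    (h : ∀ x ∈ s, HasDerivAt u 0 x) : ∀ x ∈ s, ∀ y ∈ s, u x = u y := by
  intro x hx y hy
  have := hs.norm_image_sub_le_of_norm_hasDerivWithin_le (f := u) (f' := fun _ => 0) (C := 0)
    (fun x hx => (h x hx).hasDerivWithinAt) (by simp) hx hy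
  simp at this
  linarith [sub_eq_zero.1 this]

lemma hasDerivAt_pow_aux (k : ℕ) (r : ℝ) (hr : r ≠ 0) :
    HasDerivAt (fun r : ℝ => r ^ k) (k * r ^ k / r) r := by
  refine (hasDerivAt_pow k r).congr_deriv ?_
  cases k with
  | zero => simp
  | succ n => field_simp; simp; ring

/-- the regular factor -/
noncomputable def aa (k : ℕ) (r : ℝ) : ℝ := ((k : ℝ) - 1) + 2 / (1 + r ^ 2)
noncomputable def dd (k : ℕ) (r : ℝ) : ℝ := k * aa k r - 4 * r ^ 2 / (1 + r ^ 2) ^ 2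

lemma hasDerivAt_aa (k : ℕ) (r : ℝ) :
    HasDerivAt (aa k) (- 4 * r / (1 + r ^ 2) ^ 2) r := by
  have h : (1 + r ^ 2) ≠ 0 := by positivity
  have h1 : HasDerivAt (fun r : ℝ => 1 + r ^ 2) (2 * r) r := by
    simpa using ((hasDerivAt_id r).pow 2).const_add 1
  have := ((hasDerivAt_const r (2 : ℝ)).fun_div h1 h).const_add ((k : ℝ) - 1)
  refine HasDerivAt.congr_deriv this ?_
  field_simp; ring

lemma hasDerivAt_dd (k : ℕ) (r : ℝ) :
    HasDerivAt (dd k) (k * (- 4 * r / (1 + r ^ 2) ^ 2)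
      - (8 * r * (1 + r ^ 2) - 16 * r ^ 3) / (1 + r ^ 2) ^ 3) r := by
  have h : (1 + r ^ 2) ≠ 0 := by positivity
  have h1 : HasDerivAt (fun r : ℝ => (1 + r ^ 2) ^ 2) (2 * (1 + r ^ 2) * (2 * r)) r := by
    have h0 : HasDerivAt (fun r : ℝ => 1 + r ^ 2) (2 * r) r := by
      simpa using ((hasDerivAt_id r).pow 2).const_add 1
    simpa using h0.fun_pow 2
  have h2 : HasDerivAt (fun r : ℝ => 4 * r ^ 2) (8 * r) r := by
    refine ((hasDerivAt_pow 2 r).const_mul 4).congr_deriv ?_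
    simp; ring
  have := ((hasDerivAt_aa k r).const_mul (k : ℝ)).fun_sub (h2.fun_div h1 (by positivity))
  refine HasDerivAt.congr_deriv this ?_
  field_simp; ring

lemma wronskian_aux (k : ℕ) (f f1 f2 : ℝ → ℝ) (hf : ∀ r, HasDerivAt f (f1 r) r)
    (hf1 : ∀ r, HasDerivAt f1 (f2 r) r)
    (ode : ∀ r > 0, r ^ 2 * f2 r + r * f1 r = ((k : ℝ) ^ 2 - 8 * r ^ 2 / (1 + r ^ 2) ^ 2) * f r) :
    ∀ r > 0, aa k r * (r * f1 r) = dd k r * f r := by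
  intro r hr
  set W : ℝ → ℝ := fun r => r ^ k * (aa k r * (r * f1 r) - dd k r * f r) with hW
  have hWc : Continuous W := by
    have c1 : Continuous f := continuous_iff_continuousAt.2 fun x => (hf x).continuousAt
    have c2 : Continuous f1 := continuous_iff_continuousAt.2 fun x => (hf1 x).continuousAt
    have c3 : Continuous (aa k) :=
      continuous_iff_continuousAt.2 fun x => (hasDerivAt_aa k x).continuousAt
    have c4 : Continuous (dd k) :=
      continuous_iff_continuousAt.2 fun x => (hasDerivAt_dd k x).continuousAt
    fun_prop
  have hd : ∀ x ∈ Ioo 0 r, HasDerivAt W ((fun _ => 0) x) x := by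
    intro x hx
    have hx0 : x ≠ 0 := hx.1.ne'
    have h : (1 + x ^ 2) ≠ 0 := by positivity
    have := (hasDerivAt_pow_aux k x hx0).fun_mul
      (((hasDerivAt_aa k x).fun_mul ((hasDerivAt_id x).fun_mul (hf1 x))).fun_sub
        ((hasDerivAt_dd k x).fun_mul (hf x)))
    refine HasDerivAt.congr_deriv this ?_
    have e := ode x hx.1
    have e2 : f2 x = (((k : ℝ) ^ 2 - 8 * x ^ 2 / (1 + x ^ 2) ^ 2) * f x - x * f1 x) / x ^ 2 := by
      field_simp at e ⊢; linarith
    simp only [dd, aa, id]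
    rw [e2]
    field_simp
    ring
  obtain ⟨c, hc, h⟩ := exists_hasDerivAt_eq_slope W (fun _ => 0) hr hWc.continuousOn hd
  have h0 : W 0 = 0 := by
    rcases Nat.eq_zero_or_pos k with h | h
    · subst h; simp [hW, dd]
    · simp [hW, h.ne']
  rw [h0] at h
  have : W r = 0 := by
    rw [sub_zero, sub_zero, eq_comm, div_eq_zero_iff] at h
    exact h.resolve_right hr.ne'
  have hp : r ^ k ≠ 0 := by positivity
  have := (mul_eq_zero.1 this).resolve_left hp
  linarith

lemma mode_pos (k : ℕ) (hk : 1 ≤ k) (f f1 f2 : ℝ → ℝ) (hf : ∀ r, HasDerivAt f (f1 r) r)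
    (hf1 : ∀ r, HasDerivAt f1 (f2 r) r)
    (ode : ∀ r > 0, r ^ 2 * f2 r + r * f1 r = ((k : ℝ) ^ 2 - 8 * r ^ 2 / (1 + r ^ 2) ^ 2) * f r) :
    ∃ c, ∀ r > 0, f r = c * (r ^ k * aa k r) := by
  have hw := wronskian_aux k f f1 f2 hf hf1 ode
  have hk' : (1 : ℝ) ≤ k := by exact_mod_cast hk
  have hapos : ∀ r, 0 < aa k r := by
    intro r
    have : 0 < 2 / (1 + r ^ 2) := by positivity
    simp only [aa]; linarith
  have hd : ∀ x ∈ Ioi (0 : ℝ), HasDerivAt (fun r => f r / (r ^ k * aa k r)) 0 x := by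
    intro x hx
    have hx : 0 < x := hx
    have ha := hapos x
    have hq : x ^ k * aa k x ≠ 0 := by positivity
    refine ((hf x).fun_div ((hasDerivAt_pow_aux k x hx.ne').fun_mul (hasDerivAt_aa k x)) hq).congr_deriv ?_
    have e := hw x hx
    have : f1 x = dd k x * f x / (aa k x * x) := by
      field_simp; linarith
    rw [this]
    simp only [dd]
    field_simp
    ring
  have hc := const_of_deriv_zero_aux _ _ (convex_Ioi 0) hd
  refine ⟨f 1 / (1 ^ k * aa k 1), fun r hr => ?_⟩
  have := hc r hr 1 (by simp)
  rw [← this]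
  have ha := hapos r
  field_simp

lemma mode_ge_two (k : ℕ) (hk : 2 ≤ k) (f f1 f2 : ℝ → ℝ) (hf : ∀ r, HasDerivAt f (f1 r) r)
    (hf1 : ∀ r, HasDerivAt f1 (f2 r) r)
    (ode : ∀ r > 0, r ^ 2 * f2 r + r * f1 r = ((k : ℝ) ^ 2 - 8 * r ^ 2 / (1 + r ^ 2) ^ 2) * f r)
    (C : ℝ) (hC : ∀ r, |f r| ≤ C) : ∀ r > 0, f r = 0 := by
  obtain ⟨c, hc⟩ := mode_pos k (by omega) f f1 f2 hf hf1 ode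
  have hk' : (2 : ℝ) ≤ k := by exact_mod_cast hk
  suffices c = 0 by intro r hr; rw [hc r hr, this, zero_mul]
  by_contra hne
  have hcp : 0 < |c| := abs_pos.2 hne
  have hC0 : 0 ≤ C := (abs_nonneg _).trans (hC 0)
  set r : ℝ := C / |c| + 1 with hr
  have hr1 : 1 ≤ r := by rw [hr]; have : 0 ≤ C / |c| := by positivity
                         linarith
  have h1 := hC r
  rw [hc r (by linarith), abs_mul] at h1
  have ha : 1 ≤ aa k r := by
    have : 0 < 2 / (1 + r ^ 2) := by positivity
    simp only [aa]; linarith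
  have hp : r ≤ r ^ k := le_self_pow₀ hr1 (by omega)
  have h2 : r ≤ |r ^ k * aa k r| := by
    refine le_trans ?_ (le_abs_self _)
    nlinarith
  have h3 : |c| * r ≤ C := (mul_le_mul_of_nonneg_left h2 hcp.le).trans h1
  rw [hr] at h3
  field_simp at h3
  linarith

lemma mode_zero (f f1 f2 : ℝ → ℝ) (hf : ∀ r, HasDerivAt f (f1 r) r)
    (hf1 : ∀ r, HasDerivAt f1 (f2 r) r)
    (ode : ∀ r > 0, r ^ 2 * f2 r + r * f1 r = (((0 : ℕ) : ℝ) ^ 2 - 8 * r ^ 2 / (1 + r ^ 2) ^ 2) * f r) :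
    ∃ c, ∀ r > 0, f r = c * ((1 - r ^ 2) / (1 + r ^ 2)) := by
  have hw := wronskian_aux 0 f f1 f2 hf hf1 ode
  have hw' : ∀ r > 0, (1 - r ^ 2) * (1 + r ^ 2) * f1 r = - 4 * r * f r := by
    intro r hr
    have h : (1 + r ^ 2) ≠ 0 := by positivity
    have := hw r hr
    simp only [aa, dd] at this
    field_simp at this
    push_cast at this
    apply mul_left_cancel₀ hr.ne'
    linarith
  have hf10 : f 1 = 0 := by
    have := hw' 1 one_pos
    norm_num at this; exact this
  set p : ℝ → ℝ := fun r => (1 + r ^ 2) * f r with hp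
  have hpd : ∀ r, HasDerivAt p (2 * r * f r + (1 + r ^ 2) * f1 r) r := by
    intro r
    have h1 : HasDerivAt (fun r : ℝ => 1 + r ^ 2) (2 * r) r := by
      simpa using ((hasDerivAt_id r).pow 2).const_add 1
    exact h1.fun_mul (hf r)
  have hm : ∀ r : ℝ, HasDerivAt (fun r : ℝ => 1 - r ^ 2) (- (2 * r)) r := by
    intro r
    simpa using ((hasDerivAt_id r).pow 2).const_sub 1
  set q : ℝ → ℝ := fun r => p r / (1 - r ^ 2) with hq
  have hqd : ∀ r > 0, r ≠ 1 → HasDerivAt q 0 r := by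
    intro r hr hr1
    have hne : (1 - r ^ 2) ≠ 0 := by
      intro h
      have : (1 - r) * (1 + r) = 0 := by linarith
      rcases mul_eq_zero.1 this with h | h
      · exact hr1 (by linarith)
      · linarith
    refine ((hpd r).fun_div (hm r) hne).congr_deriv ?_
    have := hw' r hr
    field_simp
    simp only [hp]
    linear_combination this
  obtain ⟨L, hL⟩ : ∃ L, Tendsto q (𝓝[≠] 1) (𝓝 L) := by
    have h1 := (hpd 1).tendsto_slope
    have h2 : Tendsto (fun r : ℝ => (-(1 + r))⁻¹) (𝓝[≠] 1) (𝓝 (-(1 + 1))⁻¹) := by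
      refine Tendsto.mono_left ?_ nhdsWithin_le_nhds
      have : ContinuousAt (fun r : ℝ => (-(1 + r))⁻¹) 1 := by
        apply ContinuousAt.inv₀
        · fun_prop
        · norm_num
      exact this
    refine ⟨_, (h1.mul h2).congr' ?_⟩
    filter_upwards [self_mem_nhdsWithin, mem_nhdsWithin_of_mem_nhds (Ioi_mem_nhds (zero_lt_one' ℝ))] with r hr hr0
    have hr0 : 0 < r := hr0
    have hr : r ≠ 1 := hr
    have e1 : r - 1 ≠ 0 := sub_ne_zero.2 hr
    have e2 : 1 + r ≠ 0 := by positivity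
    have e3 : 1 - r ^ 2 = -((r - 1) * (1 + r)) := by ring
    simp only [slope, hq, vsub_eq_sub, smul_eq_mul]
    rw [show p 1 = 0 by simp [hp, hf10], e3]
    field_simp
    ring
  have key : ∀ r > 0, r ≠ 1 → q r = L := by
    intro r hr hr1
    rcases lt_or_gt_of_ne hr1 with h | h
    · have hc := const_of_deriv_zero_aux q (Ioo 0 1) (convex_Ioo 0 1)
        (fun x hx => hqd x hx.1 hx.2.ne)
      have h1 : Tendsto q (𝓝[<] 1) (𝓝 L) :=
        hL.mono_left (nhdsWithin_mono _ (fun x hx => ne_of_lt hx))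
      have h2 : Tendsto q (𝓝[<] 1) (𝓝 (q r)) := by
        refine tendsto_const_nhds.congr' ?_
        filter_upwards [Ioo_mem_nhdsLT (zero_lt_one' ℝ)] with x hx
        exact hc r ⟨hr, h⟩ x hx
      exact tendsto_nhds_unique h2 h1
    · have hc := const_of_deriv_zero_aux q (Ioi 1) (convex_Ioi 1)
        (fun x hx => hqd x (lt_trans one_pos hx) (ne_of_gt hx))
      have h1 : Tendsto q (𝓝[>] 1) (𝓝 L) :=
        hL.mono_left (nhdsWithin_mono _ (fun x hx => ne_of_gt hx))
      have h2 : Tendsto q (𝓝[>] 1) (𝓝 (q r)) := by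
        refine tendsto_const_nhds.congr' ?_
        filter_upwards [self_mem_nhdsWithin] with x hx
        exact hc r h x hx
      exact tendsto_nhds_unique h2 h1
  refine ⟨L, fun r hr => ?_⟩
  by_cases h1 : r = 1
  · subst h1; simp [hf10]
  · have hne : (1 - r ^ 2) ≠ 0 := by
      intro h
      have : (1 - r) * (1 + r) = 0 := by linarith
      rcases mul_eq_zero.1 this with h | h
      · exact h1 (by linarith)
      · linarith
    rw [← key r hr h1]
    simp only [hq, hp]
    field_simp

lemma extend_zero (f g : ℝ → ℝ) (hf : Continuous f) (hg : Continuous g)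
    (h : ∀ r > 0, f r = g r) : ∀ r ≥ 0, f r = g r := by
  have : IsClosed {r | f r = g r} := isClosed_eq hf hg
  have h2 : closure (Ioi (0:ℝ)) ⊆ {r | f r = g r} := this.closure_subset_iff.2 h
  rw [closure_Ioi] at h2
  exact fun r hr => h2 hr

lemma deriv_under_int (G G' : ℝ → ℝ → ℝ) (hG : Continuous (fun p : ℝ × ℝ => G p.1 p.2))
    (hG' : Continuous (fun p : ℝ × ℝ => G' p.1 p.2))
    (hd : ∀ r t, HasDerivAt (fun r => G r t) (G' r t) r) (r : ℝ) :
    HasDerivAt (fun r => ∫ t in (0:ℝ)..(2 * π), G r t) (∫ t in (0:ℝ)..(2 * π), G' r t) r := by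
  obtain ⟨C, hC⟩ := ((isCompact_closedBall r 1).prod
    (isCompact_uIcc (a := (0:ℝ)) (b := 2 * π))).exists_bound_of_continuousOn hG'.continuousOn
  have c1 : ∀ x, Continuous (G x) := fun x => hG.comp (by fun_prop : Continuous fun t => (x, t))
  have c2 : ∀ x, Continuous (G' x) := fun x => hG'.comp (by fun_prop : Continuous fun t => (x, t))
  refine (intervalIntegral.hasDerivAt_integral_of_dominated_loc_of_deriv_le
    (bound := fun _ => C) (Metric.closedBall_mem_nhds r one_pos) ?_ ?_ ?_ ?_ ?_ ?_).2
  · exact Eventually.of_forall fun x => (c1 x).aestronglyMeasurable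
  · exact (c1 r).intervalIntegrable _ _
  · exact (c2 r).aestronglyMeasurable
  · exact Eventually.of_forall fun t ht x hx => hC (x, t) ⟨hx, uIoc_subset_uIcc ht⟩
  · exact intervalIntegrable_const
  · exact Eventually.of_forall fun t ht x hx => hd x t

lemma chain_aux (ψ : ℝ × ℝ → ℝ) (hψ : ContDiff ℝ 1 ψ) (x y : ℝ → ℝ) (x' y' t : ℝ)
    (hx : HasDerivAt x x' t) (hy : HasDerivAt y y' t) :
    HasDerivAt (fun t => ψ (x t, y t))
      (fderiv ℝ ψ (x t, y t) (1, 0) * x' + fderiv ℝ ψ (x t, y t) (0, 1) * y') t := by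
  have h := ((hψ.differentiable one_ne_zero) (x t, y t)).hasFDerivAt
  have h2 := h.comp_hasDerivAt t (hx.prodMk hy)
  refine h2.congr_deriv ?_
  have : (x', y') = x' • ((1:ℝ), (0:ℝ)) + y' • ((0:ℝ), (1:ℝ)) := by simp
  rw [this, map_add, map_smul, map_smul, smul_eq_mul, smul_eq_mul]
  ring

lemma lap_eq_aux (φ : ℝ × ℝ → ℝ) (hφ : ContDiff ℝ 2 φ)
    (hP : ContDiff ℝ 1 (fun z => fderiv ℝ φ z (1, 0)))
    (hQ : ContDiff ℝ 1 (fun z => fderiv ℝ φ z (0, 1))) (z : ℝ × ℝ) :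
    lap φ z = fderiv ℝ (fun z => fderiv ℝ φ z (1, 0)) z (1, 0)
      + fderiv ℝ (fun z => fderiv ℝ φ z (0, 1)) z (0, 1) := by
  have h1 : ContDiff ℝ 1 φ := hφ.of_le (by norm_num)
  have e1 : deriv (fun x => φ (x, z.2)) = fun x => fderiv ℝ φ (x, z.2) (1, 0) := by
    ext x
    have := (chain_aux φ h1 (fun x => x) (fun _ => z.2) 1 0 x (hasDerivAt_id x)
      (hasDerivAt_const x _)).deriv
    simpa using this
  have e2 : deriv (fun y => φ (z.1, y)) = fun y => fderiv ℝ φ (z.1, y) (0, 1) := by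
    ext x
    have := (chain_aux φ h1 (fun _ => z.1) (fun x => x) 0 1 x (hasDerivAt_const x _)
      (hasDerivAt_id x)).deriv
    simpa using this
  have e3 := (chain_aux _ hP (fun x => x) (fun _ => z.2) 1 0 z.1 (hasDerivAt_id _)
      (hasDerivAt_const _ _)).deriv
  have e4 := (chain_aux _ hQ (fun _ => z.1) (fun x => x) 0 1 z.2 (hasDerivAt_const _ _)
      (hasDerivAt_id _)).deriv
  rw [lap, e1, e2, e3, e4]
  simp

noncomputable def modeInt (φ : ℝ × ℝ → ℝ) (g : ℝ → ℝ) (r : ℝ) : ℝ :=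
  ∫ t in (0:ℝ)..(2 * π), φ (r * cos t, r * sin t) * g t

lemma polar_ode (φ : ℝ × ℝ → ℝ) (hφ : ContDiff ℝ 2 φ)
    (hpde : ∀ z : ℝ × ℝ, lap φ z + 8 / (1 + (z.1 ^ 2 + z.2 ^ 2)) ^ 2 * φ z = 0)
    (k : ℕ) (g g1 : ℝ → ℝ) (hg : ∀ t, HasDerivAt g (g1 t) t)
    (hg1 : ∀ t, HasDerivAt g1 (-(k : ℝ) ^ 2 * g t) t) (hp : g (2 * π) = g 0)
    (hp1 : g1 (2 * π) = g1 0) :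
    ∃ f1 f2 : ℝ → ℝ, (∀ r, HasDerivAt (modeInt φ g) (f1 r) r) ∧ (∀ r, HasDerivAt f1 (f2 r) r) ∧
      (∀ r > 0, r ^ 2 * f2 r + r * f1 r
        = ((k : ℝ) ^ 2 - 8 * r ^ 2 / (1 + r ^ 2) ^ 2) * modeInt φ g r) := by
  have h1 : ContDiff ℝ 1 φ := hφ.of_le (by norm_num)
  have hD : ContDiff ℝ 1 (fderiv ℝ φ) := hφ.fderiv_right (by norm_num)
  have hP : ContDiff ℝ 1 (fun z => fderiv ℝ φ z (1, 0)) := hD.clm_apply contDiff_const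
  have hQ : ContDiff ℝ 1 (fun z => fderiv ℝ φ z (0, 1)) := hD.clm_apply contDiff_const
  have hlap := lap_eq_aux φ hφ hP hQ
  set P : ℝ × ℝ → ℝ := fun z => fderiv ℝ φ z (1, 0) with hPdef
  set Q : ℝ × ℝ → ℝ := fun z => fderiv ℝ φ z (0, 1) with hQdef
  have chφ := chain_aux φ h1
  have chP := chain_aux P hP
  have chQ := chain_aux Q hQ
  have cpx : Continuous (fun z => fderiv ℝ P z (1, 0)) :=
    (hP.continuous_fderiv one_ne_zero).clm_apply continuous_const
  have cpy : Continuous (fun z => fderiv ℝ P z (0, 1)) :=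
    (hP.continuous_fderiv one_ne_zero).clm_apply continuous_const
  have cqx : Continuous (fun z => fderiv ℝ Q z (1, 0)) :=
    (hQ.continuous_fderiv one_ne_zero).clm_apply continuous_const
  have cqy : Continuous (fun z => fderiv ℝ Q z (0, 1)) :=
    (hQ.continuous_fderiv one_ne_zero).clm_apply continuous_const
  change ∀ (x y : ℝ → ℝ) (x' y' t : ℝ), HasDerivAt x x' t → HasDerivAt y y' t →
    HasDerivAt (fun t => φ (x t, y t)) (P (x t, y t) * x' + Q (x t, y t) * y') t at chφ
  have cP := hP.continuous
  have cQ := hQ.continuous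
  have cφ := hφ.continuous
  clear_value P Q
  generalize hpx : (fun z => fderiv ℝ P z (1, 0)) = px at *
  generalize hpy : (fun z => fderiv ℝ P z (0, 1)) = py at *
  generalize hqx : (fun z => fderiv ℝ Q z (1, 0)) = qx at *
  generalize hqy : (fun z => fderiv ℝ Q z (0, 1)) = qy at *
  simp only [fun z => congrFun hpx z, fun z => congrFun hpy z, fun z => congrFun hqx z,
    fun z => congrFun hqy z] at chP chQ hlap
  have cg : Continuous g := continuous_iff_continuousAt.2 fun x => (hg x).continuousAt
  have cg1 : Continuous g1 := continuous_iff_continuousAt.2 fun x => (hg1 x).continuousAt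
  -- derivatives in the radial direction
  have hrx : ∀ r t : ℝ, HasDerivAt (fun r => r * cos t) (cos t) r := fun r t => by
    simpa using (hasDerivAt_id r).mul_const (cos t)
  have hry : ∀ r t : ℝ, HasDerivAt (fun r => r * sin t) (sin t) r := fun r t => by
    simpa using (hasDerivAt_id r).mul_const (sin t)
  have htx : ∀ r t : ℝ, HasDerivAt (fun t => r * cos t) (r * -sin t) t := fun r t =>
    (hasDerivAt_cos t).const_mul r
  have hty : ∀ r t : ℝ, HasDerivAt (fun t => r * sin t) (r * cos t) t := fun r t =>
    (hasDerivAt_sin t).const_mul r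
  set F1 : ℝ → ℝ → ℝ := fun r t => (P (r * cos t, r * sin t) * cos t
    + Q (r * cos t, r * sin t) * sin t) * g t with hF1
  set F2 : ℝ → ℝ → ℝ := fun r t => ((px (r * cos t, r * sin t) * cos t
      + py (r * cos t, r * sin t) * sin t) * cos t
    + (qx (r * cos t, r * sin t) * cos t
      + qy (r * cos t, r * sin t) * sin t) * sin t) * g t with hF2
  refine ⟨fun r => ∫ t in (0:ℝ)..(2 * π), F1 r t, fun r => ∫ t in (0:ℝ)..(2 * π), F2 r t,
    fun r => ?_, fun r => ?_, fun r hr => ?_⟩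
  · refine deriv_under_int (fun r t => φ (r * cos t, r * sin t) * g t) F1 (by fun_prop)
      (by fun_prop) (fun r t => ?_) r
    exact (chφ _ _ _ _ _ (hrx r t) (hry r t)).mul_const _
  · refine deriv_under_int F1 F2 (by fun_prop) (by fun_prop) (fun r t => ?_) r
    exact (((chP _ _ _ _ _ (hrx r t) (hry r t)).mul_const _).add
      ((chQ _ _ _ _ _ (hrx r t) (hry r t)).mul_const _)).mul_const _
  · set H : ℝ → ℝ := fun t => (P (r * cos t, r * sin t) * (r * -sin t)
      + Q (r * cos t, r * sin t) * (r * cos t)) * g t - φ (r * cos t, r * sin t) * g1 t with hH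
    set H' : ℝ → ℝ := fun t => ((k : ℝ) ^ 2 - 8 * r ^ 2 / (1 + r ^ 2) ^ 2) *
      (φ (r * cos t, r * sin t) * g t) - (r ^ 2 * F2 r t + r * F1 r t) with hH'
    have cF1 : Continuous (F1 r) := by fun_prop
    have cF2 : Continuous (F2 r) := by fun_prop
    have cF0 : Continuous (fun t => φ (r * cos t, r * sin t) * g t) := by fun_prop
    have cH' : Continuous H' := by fun_prop
    have hHd : ∀ t, HasDerivAt H (H' t) t := by
      intro t
      have d1 := (htx r t)
      have d3 : HasDerivAt (fun t => r * -sin t) (r * - cos t) t :=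
        (hasDerivAt_sin t).neg.const_mul r
      have := ((((chP _ _ _ _ _ d1 (hty r t)).fun_mul d3).fun_add
        ((chQ _ _ _ _ _ d1 (hty r t)).fun_mul d1)).fun_mul (hg t)).fun_sub
        ((chφ _ _ _ _ _ d1 (hty r t)).fun_mul (hg1 t))
      refine this.congr_deriv ?_
      have e := hpde (r * cos t, r * sin t)
      rw [hlap] at e
      simp only at e
      have e0 : (r * cos t) ^ 2 + (r * sin t) ^ 2 = r ^ 2 := by
        have := sin_sq_add_cos_sq t
        linear_combination r ^ 2 * this
      rw [e0] at e
      simp only [hH', hF1, hF2]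
      have e5 : 8 * r ^ 2 / (1 + r ^ 2) ^ 2 * φ (r * cos t, r * sin t) =
        - r ^ 2 * (px (r * cos t, r * sin t) + qy (r * cos t, r * sin t)) := by
        linear_combination r ^ 2 * e
      generalize px (r * cos t, r * sin t) = a1 at *
      generalize py (r * cos t, r * sin t) = a2 at *
      generalize qx (r * cos t, r * sin t) = a3 at *
      generalize qy (r * cos t, r * sin t) = a4 at *
      have e6 := sin_sq_add_cos_sq t
      linear_combination g t * e5 + r ^ 2 * (a1 + a4) * g t * e6
    have hint := intervalIntegral.integral_eq_sub_of_hasDerivAt (a := 0) (b := 2 * π)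
      (fun x _ => hHd x) (cH'.intervalIntegrable _ _)
    have hz : H (2 * π) - H 0 = 0 := by simp [hH, hp, hp1]
    rw [hz, hH', intervalIntegral.integral_sub, intervalIntegral.integral_add,
      intervalIntegral.integral_const_mul, intervalIntegral.integral_const_mul,
      intervalIntegral.integral_const_mul] at hint
    · simp only [modeInt]; linarith
    all_goals apply Continuous.intervalIntegrable; fun_prop

lemma modeInt_bdd (φ : ℝ × ℝ → ℝ) (c : ℝ) (hc : ∀ z, |φ z| ≤ c) (g : ℝ → ℝ)
    (hg : ∀ t, |g t| ≤ 1) (r : ℝ) : |modeInt φ g r| ≤ c * (2 * π) := by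
  have := intervalIntegral.norm_integral_le_of_norm_le_const (a := 0) (b := 2 * π) (C := c)
    (f := fun t => φ (r * cos t, r * sin t) * g t) (fun t _ => by
      rw [norm_mul]
      have h1 := hc (r * cos t, r * sin t)
      have h2 := hg t
      simp only [Real.norm_eq_abs]
      nlinarith [abs_nonneg (g t), abs_nonneg (φ (r * cos t, r * sin t))])
  rwa [sub_zero, abs_of_pos Real.two_pi_pos] at this

lemma mode_cos (φ : ℝ × ℝ → ℝ) (hφ : ContDiff ℝ 2 φ)
    (hpde : ∀ z : ℝ × ℝ, lap φ z + 8 / (1 + (z.1 ^ 2 + z.2 ^ 2)) ^ 2 * φ z = 0) (k : ℕ) :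
    ∃ f1 f2 : ℝ → ℝ, (∀ r, HasDerivAt (modeInt φ (fun t => cos (k * t))) (f1 r) r) ∧
      (∀ r, HasDerivAt f1 (f2 r) r) ∧
      (∀ r > 0, r ^ 2 * f2 r + r * f1 r
        = ((k : ℝ) ^ 2 - 8 * r ^ 2 / (1 + r ^ 2) ^ 2) * modeInt φ (fun t => cos (k * t)) r) := by
  have hk : ∀ t : ℝ, HasDerivAt (fun t : ℝ => k * t) (k : ℝ) t := fun t => by
    simpa using (hasDerivAt_id t).const_mul (k : ℝ)
  refine polar_ode φ hφ hpde k _ (fun t => -sin (k * t) * k) (fun t => (hk t).cos) (fun t => ?_)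
    ?_ ?_
  · refine ((hk t).sin.fun_neg.mul_const (k : ℝ)).congr_deriv ?_
    ring
  · simp [Real.cos_nat_mul_two_pi]
  · have : sin (k * (2 * π)) = 0 := by
      have := Real.sin_nat_mul_pi (2 * k)
      push_cast at this
      rw [← this]; congr 1; ring
    simp [this]

lemma mode_sin (φ : ℝ × ℝ → ℝ) (hφ : ContDiff ℝ 2 φ)
    (hpde : ∀ z : ℝ × ℝ, lap φ z + 8 / (1 + (z.1 ^ 2 + z.2 ^ 2)) ^ 2 * φ z = 0) (k : ℕ) :
    ∃ f1 f2 : ℝ → ℝ, (∀ r, HasDerivAt (modeInt φ (fun t => sin (k * t))) (f1 r) r) ∧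
      (∀ r, HasDerivAt f1 (f2 r) r) ∧
      (∀ r > 0, r ^ 2 * f2 r + r * f1 r
        = ((k : ℝ) ^ 2 - 8 * r ^ 2 / (1 + r ^ 2) ^ 2) * modeInt φ (fun t => sin (k * t)) r) := by
  have hk : ∀ t : ℝ, HasDerivAt (fun t : ℝ => k * t) (k : ℝ) t := fun t => by
    simpa using (hasDerivAt_id t).const_mul (k : ℝ)
  refine polar_ode φ hφ hpde k _ (fun t => cos (k * t) * k) (fun t => (hk t).sin) (fun t => ?_)
    ?_ ?_
  · refine ((hk t).cos.mul_const (k : ℝ)).congr_deriv ?_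
    ring
  · have : sin (k * (2 * π)) = 0 := by
      have := Real.sin_nat_mul_pi (2 * k)
      push_cast at this
      rw [← this]; congr 1; ring
    simp [this]
  · simp [Real.cos_nat_mul_two_pi]

/-- A continuous periodic function with vanishing higher modes is a first order trigonometric
polynomial. -/
lemma trig_poly_of_modes (h : ℝ → ℝ) (hc : Continuous h) (hper : Function.Periodic h (2 * π))
    (hcos : ∀ k : ℕ, 2 ≤ k → ∫ t in (0:ℝ)..(2 * π), h t * cos (k * t) = 0)
    (hsin : ∀ k : ℕ, 2 ≤ k → ∫ t in (0:ℝ)..(2 * π), h t * sin (k * t) = 0) (x : ℝ) :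
    h x = (1 / (2 * π)) * (∫ t in (0:ℝ)..(2 * π), h t * cos ((0:ℕ) * t))
      + (1 / π) * (∫ t in (0:ℝ)..(2 * π), h t * cos ((1:ℕ) * t)) * cos x
      + (1 / π) * (∫ t in (0:ℝ)..(2 * π), h t * sin ((1:ℕ) * t)) * sin x := by
  have : Fact (0 < 2 * π) := ⟨Real.two_pi_pos⟩
  have hper' : Function.Periodic (fun t => (h t : ℂ)) (2 * π) := fun t => by simp [hper t]
  have hcl : Continuous (hper'.lift : AddCircle (2 * π) → ℂ) := by
    apply continuous_coinduced_dom.2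
    have : Continuous fun t => (h t : ℂ) := by fun_prop
    exact this
  set f : C(AddCircle (2 * π), ℂ) := ⟨hper'.lift, hcl⟩ with hf
  have hfx : ∀ t : ℝ, f (t : AddCircle (2 * π)) = (h t : ℂ) := fun t => rfl
  have hpi : (π : ℂ) ≠ 0 := by exact_mod_cast Real.pi_ne_zero
  have hfour : ∀ (n : ℤ) (t : ℝ), (fourier n (t : AddCircle (2 * π)) : ℂ)
      = (cos (n * t) : ℂ) + (sin (n * t) : ℂ) * Complex.I := by
    intro n t
    rw [fourier_coe_apply, Complex.ofReal_cos, Complex.ofReal_sin, ← Complex.exp_mul_I]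
    congr 1
    push_cast
    field_simp
  have hcoef : ∀ n : ℤ, fourierCoeff f n = (1 / (2 * π) : ℂ) *
      (((∫ t in (0:ℝ)..(2 * π), h t * cos (n * t) : ℝ) : ℂ)
        - ((∫ t in (0:ℝ)..(2 * π), h t * sin (n * t) : ℝ) : ℂ) * Complex.I) := by
    intro n
    rw [fourierCoeff_eq_intervalIntegral f n 0, zero_add]
    rw [← intervalIntegral.integral_ofReal, ← intervalIntegral.integral_ofReal,
      ← intervalIntegral.integral_mul_const, ← intervalIntegral.integral_sub]
    · rw [Complex.real_smul]
      push_cast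
      congr 1
      apply intervalIntegral.integral_congr
      intro t _
      simp only [hfour, hfx, smul_eq_mul]
      push_cast
      rw [neg_mul, Complex.cos_neg, Complex.sin_neg]
      ring
    all_goals apply Continuous.intervalIntegrable; fun_prop
  have hzero : ∀ n : ℤ, n ∉ ({0, 1, -1} : Finset ℤ) → fourierCoeff f n = 0 := by
    intro n hn
    simp only [Finset.mem_insert, Finset.mem_singleton, not_or] at hn
    have h2 : 2 ≤ n.natAbs := by omega
    have c0 := hcos _ h2
    have s0 := hsin _ h2
    rw [hcoef]
    rcases Int.natAbs_eq n with h | h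
    · have e : (n : ℝ) = (n.natAbs : ℝ) := by
        conv_lhs => rw [h]
        simp
      rw [e, c0, s0]; simp
    · have e : (n : ℝ) = -(n.natAbs : ℝ) := by
        conv_lhs => rw [h]
        simp
      simp only [e, neg_mul, cos_neg, sin_neg, mul_neg, intervalIntegral.integral_neg]
      rw [c0, s0]; simp
  have hsum : Summable (fourierCoeff f) := (hasSum_sum_of_ne_finset_zero (L := SummationFilter.unconditional ℤ) hzero).summable
  have hs := has_pointwise_sum_fourier_series_of_summable hsum (x : AddCircle (2 * π))
  have hs2 := hasSum_sum_of_ne_finset_zero (L := SummationFilter.unconditional ℤ) (s := ({0, 1, -1} : Finset ℤ))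
    (f := fun i => fourierCoeff f i • (fourier i (x : AddCircle (2 * π)) : ℂ))
    (fun n hn => by rw [hzero n hn, zero_smul])
  have heq := hs.unique hs2
  rw [hfx] at heq
  rw [Finset.sum_insert (by decide), Finset.sum_insert (by decide), Finset.sum_singleton] at heq
  simp only [hcoef, hfour, smul_eq_mul] at heq
  have hre := congrArg Complex.re heq
  simp only [Int.cast_zero, zero_mul, Int.cast_one, one_mul, Int.cast_neg, neg_mul, cos_neg,
    sin_neg, mul_neg, intervalIntegral.integral_neg, cos_zero, sin_zero] at hre
  simp only [Nat.cast_zero, zero_mul, Nat.cast_one, one_mul, cos_zero]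
  generalize (∫ t in (0:ℝ)..(2 * π), h t * cos t) = I1 at *
  generalize (∫ t in (0:ℝ)..(2 * π), h t * sin t) = I2 at *
  generalize (∫ t in (0:ℝ)..(2 * π), h t * 1) = I0 at *
  have e : (1 / (2 * π) : ℂ) = ((1 / (2 * π) : ℝ) : ℂ) := by push_cast; rfl
  rw [e] at hre
  have := Real.pi_ne_zero
  generalize hA : (1 / (2 * π) : ℝ) = A at hre
  generalize cos x = u at *
  generalize sin x = v at *
  simp only [Complex.add_re, Complex.sub_re, Complex.mul_re, Complex.mul_im, Complex.sub_im,
    Complex.add_im, Complex.ofReal_re, Complex.ofReal_im, Complex.I_re, Complex.I_im,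
    Complex.ofReal_neg, Complex.neg_re, Complex.neg_im, Complex.ofReal_zero, Complex.ofReal_one,
    Complex.zero_re, Complex.zero_im, Complex.one_re, Complex.one_im,
    intervalIntegral.integral_zero] at hre
  rw [hre, ← hA]
  field_simp
  ring

theorem bounded_kernel_classification
    (φ : ℝ × ℝ → ℝ) (hφ : ContDiff ℝ 2 φ)
    (hpde : ∀ z : ℝ × ℝ,
      lap φ z + 8 / (1 + (z.1 ^ 2 + z.2 ^ 2)) ^ 2 * φ z = 0)
    (hbd : ∃ c : ℝ, 0 < c ∧ ∀ z : ℝ × ℝ, |φ z| ≤ c) :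
    ∃ b₀ b₁ b₂ : ℝ, ∀ z : ℝ × ℝ,
      φ z = b₀ * Y0 z + b₁ * Y1 z + b₂ * Y2 z := by
  obtain ⟨C, -, hC⟩ := hbd
  have contC : ∀ k : ℕ, Continuous (modeInt φ (fun t => cos (k * t))) := fun k => by
    obtain ⟨f1, f2, h1, -, -⟩ := mode_cos φ hφ hpde k
    exact continuous_iff_continuousAt.2 fun x => (h1 x).continuousAt
  have contS : ∀ k : ℕ, Continuous (modeInt φ (fun t => sin (k * t))) := fun k => by
    obtain ⟨f1, f2, h1, -, -⟩ := mode_sin φ hφ hpde k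
    exact continuous_iff_continuousAt.2 fun x => (h1 x).continuousAt
  have ha : Continuous (aa 1) :=
    continuous_iff_continuousAt.2 fun x => (hasDerivAt_aa 1 x).continuousAt
  have hcos : ∀ k : ℕ, 2 ≤ k → ∀ r ≥ 0, modeInt φ (fun t => cos (k * t)) r = 0 := by
    intro k hk
    obtain ⟨f1, f2, h1, h2, h3⟩ := mode_cos φ hφ hpde k
    exact extend_zero _ (fun _ => 0) (contC k) continuous_const
      (mode_ge_two k hk _ f1 f2 h1 h2 h3 _ (modeInt_bdd φ C hC _ fun t => abs_cos_le_one _))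
  have hsin : ∀ k : ℕ, 2 ≤ k → ∀ r ≥ 0, modeInt φ (fun t => sin (k * t)) r = 0 := by
    intro k hk
    obtain ⟨f1, f2, h1, h2, h3⟩ := mode_sin φ hφ hpde k
    exact extend_zero _ (fun _ => 0) (contS k) continuous_const
      (mode_ge_two k hk _ f1 f2 h1 h2 h3 _ (modeInt_bdd φ C hC _ fun t => abs_sin_le_one _))
  obtain ⟨c0, hc0⟩ : ∃ c, ∀ r ≥ 0, modeInt φ (fun t => cos ((0:ℕ) * t)) r
      = c * ((1 - r ^ 2) / (1 + r ^ 2)) := by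
    obtain ⟨f1, f2, h1, h2, h3⟩ := mode_cos φ hφ hpde 0
    obtain ⟨c, hc⟩ := mode_zero _ f1 f2 h1 h2 h3
    refine ⟨c, extend_zero _ _ (contC 0) ?_ hc⟩
    have : ∀ r : ℝ, 1 + r ^ 2 ≠ 0 := fun r => by positivity
    fun_prop (disch := assumption)
  obtain ⟨c1, hc1⟩ : ∃ c, ∀ r ≥ 0, modeInt φ (fun t => cos ((1:ℕ) * t)) r
      = c * (r ^ 1 * aa 1 r) := by
    obtain ⟨f1, f2, h1, h2, h3⟩ := mode_cos φ hφ hpde 1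
    obtain ⟨c, hc⟩ := mode_pos 1 le_rfl _ f1 f2 h1 h2 h3
    exact ⟨c, extend_zero _ _ (contC 1) (by fun_prop) hc⟩
  obtain ⟨c2, hc2⟩ : ∃ c, ∀ r ≥ 0, modeInt φ (fun t => sin ((1:ℕ) * t)) r
      = c * (r ^ 1 * aa 1 r) := by
    obtain ⟨f1, f2, h1, h2, h3⟩ := mode_sin φ hφ hpde 1
    obtain ⟨c, hc⟩ := mode_pos 1 le_rfl _ f1 f2 h1 h2 h3
    exact ⟨c, extend_zero _ _ (contS 1) (by fun_prop) hc⟩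
  refine ⟨1 / (2 * π) * c0, 1 / π * c1 * 2, 1 / π * c2 * 2, fun z => ?_⟩
  set w : ℂ := ⟨z.1, z.2⟩ with hw
  have hr : 0 ≤ ‖w‖ := norm_nonneg w
  have e1 : ‖w‖ * cos (Complex.arg w) = z.1 := Complex.norm_mul_cos_arg w
  have e2 : ‖w‖ * sin (Complex.arg w) = z.2 := Complex.norm_mul_sin_arg w
  have cφ := hφ.continuous
  have key := trig_poly_of_modes (fun t => φ (‖w‖ * cos t, ‖w‖ * sin t)) (by fun_prop)
    (fun t => by simp) (fun k hk => hcos k hk _ hr) (fun k hk => hsin k hk _ hr) (Complex.arg w)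
  have k0 := hc0 _ hr
  have k1 := hc1 _ hr
  have k2 := hc2 _ hr
  simp only [modeInt] at k0 k1 k2
  rw [k0, k1, k2] at key
  simp only [e1, e2] at key
  have e3 : z.1 ^ 2 + z.2 ^ 2 = ‖w‖ ^ 2 := by
    rw [← e1, ← e2]
    have := sin_sq_add_cos_sq (Complex.arg w)
    linear_combination ‖w‖ ^ 2 * this
  rw [show φ z = φ (z.1, z.2) from rfl, key]
  simp only [Y0, Y1, Y2, aa]
  rw [e3, ← e1, ← e2]
  push_cast
  have := Real.pi_ne_zero
  field_simp
  ring
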